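/- Let 0<α<1 and 0<β<∞, let u be holomorphic on 𝔻 and φ a holomorphic self-map of 𝔻. Then uC_φ : B^α → Z_β is compact if and only if uC_φ maps B^α boundedly into Z_β, lim_{n→∞} (n+1)^α ‖(2u'φ' + uφ'')·φ^n‖_{ν_β} = 0, and lim_{n→∞} (n+1)^{α+1} ‖u·(φ')²·φ^n‖_{ν_β} = 0. -/

import Mathlib

open Complex Filter Set

noncomputable section

/-- The open unit disk in `ℂ`. -/
def unitDisk : Set ℂ := Metric.ball 0 1

/-- The weighted sup-norm `‖g‖_{ν_γ} = sup_{z ∈ 𝔻} (1-|z|²)^γ |g(z)|`. -/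
def wnorm (γ : ℝ) (g : ℂ → ℂ) : ℝ :=
  sSup ((fun z => (1 - ‖z‖ ^ 2) ^ γ * ‖g z‖) '' unitDisk)

/-- Membership in the weighted Banach space `H^∞_{ν_β}`. -/
def MemWeighted (β : ℝ) (g : ℂ → ℂ) : Prop :=
  DifferentiableOn ℂ g unitDisk ∧
    BddAbove ((fun z => (1 - ‖z‖ ^ 2) ^ β * ‖g z‖) '' unitDisk)

/-- Membership in the Bloch type space `B^α`. -/
def MemBloch (α : ℝ) (f : ℂ → ℂ) : Prop :=
  DifferentiableOn ℂ f unitDisk ∧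
    BddAbove ((fun z => (1 - ‖z‖ ^ 2) ^ α * ‖deriv f z‖) '' unitDisk)

/-- The Bloch type norm `‖f‖_{B^α} = |f(0)| + sup_{z∈𝔻}(1-|z|²)^α |f'(z)|`. -/
def blochNorm (α : ℝ) (f : ℂ → ℂ) : ℝ :=
  ‖f 0‖ + wnorm α (deriv f)

/-- Membership in the Zygmund type space `Z_β`. -/
def MemZygmund (β : ℝ) (f : ℂ → ℂ) : Prop :=
  DifferentiableOn ℂ f unitDisk ∧
    BddAbove ((fun z => (1 - ‖z‖ ^ 2) ^ β * ‖deriv (deriv f) z‖) '' unitDisk)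

/-- The Zygmund type norm `‖f‖_{Z_β} = |f(0)| + |f'(0)| + sup_{z∈𝔻}(1-|z|²)^β |f''(z)|`. -/
def zygNorm (β : ℝ) (f : ℂ → ℂ) : ℝ :=
  ‖f 0‖ + ‖deriv f 0‖ + wnorm β (deriv (deriv f))

/-- The weighted composition operator `uC_φ f = u · (f ∘ φ)`. -/
def wcomp (u φ f : ℂ → ℂ) : ℂ → ℂ := fun z => u z * f (φ z)

/-- `uC_φ` maps `B^α` boundedly into `Z_β`. -/
def BoundedBlochToZygmund (α β : ℝ) (u φ : ℂ → ℂ) : Prop :=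
  (∀ f, MemBloch α f → MemZygmund β (wcomp u φ f)) ∧
    ∃ C > 0, ∀ f, MemBloch α f → zygNorm β (wcomp u φ f) ≤ C * blochNorm α f

/-- `uC_φ` maps `B^α` boundedly into `H^∞_{ν_β}`. -/
def BoundedBlochToWeighted (α β : ℝ) (u φ : ℂ → ℂ) : Prop :=
  (∀ f, MemBloch α f → MemWeighted β (wcomp u φ f)) ∧
    ∃ C > 0, ∀ f, MemBloch α f → wnorm β (wcomp u φ f) ≤ C * blochNorm α f

/-- `uC_φ : B^α → Z_β` is compact: it is bounded and maps bounded sets of `B^α` to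
totally bounded (equivalently, since `Z_β` is complete, relatively compact) subsets
of `Z_β`. -/
def CompactBlochToZygmund (α β : ℝ) (u φ : ℂ → ℂ) : Prop :=
  BoundedBlochToZygmund α β u φ ∧
    ∀ r : ℝ, ∀ ε : ℝ, 0 < ε → ∃ T : Finset (ℂ → ℂ),
      (∀ g ∈ T, MemZygmund β g) ∧
      ∀ f, MemBloch α f → blochNorm α f ≤ r →
        ∃ g ∈ T, zygNorm β (fun z => wcomp u φ f z - g z) ≤ ε

/-- `uC_φ : B^α → H^∞_{ν_β}` is compact: it is bounded and maps bounded sets of `B^α`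
to totally bounded (equivalently, relatively compact) subsets of `H^∞_{ν_β}`. -/
def CompactBlochToWeighted (α β : ℝ) (u φ : ℂ → ℂ) : Prop :=
  BoundedBlochToWeighted α β u φ ∧
    ∀ r : ℝ, ∀ ε : ℝ, 0 < ε → ∃ T : Finset (ℂ → ℂ),
      (∀ g ∈ T, MemWeighted β g) ∧
      ∀ f, MemBloch α f → blochNorm α f ≤ r →
        ∃ g ∈ T, wnorm β (fun z => wcomp u φ f z - g z) ≤ ε

/-- A compact (linear, bounded, with totally bounded image of the unit ball) operator
from the subspace of `B^α` cut out by the predicate `P` into `Z_β`. -/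
def IsCompactOpToZygmund (α β : ℝ) (P : (ℂ → ℂ) → Prop) (K : (ℂ → ℂ) → ℂ → ℂ) : Prop :=
  (∀ f g, P f → P g → ∀ a b : ℂ,
      K (fun z => a * f z + b * g z) = fun z => a * K f z + b * K g z) ∧
  (∀ f, P f → MemZygmund β (K f)) ∧
  (∃ C, ∀ f, P f → zygNorm β (K f) ≤ C * blochNorm α f) ∧
  (∀ ε : ℝ, 0 < ε → ∃ T : Finset (ℂ → ℂ), (∀ g ∈ T, MemZygmund β g) ∧
      ∀ f, P f → blochNorm α f ≤ 1 → ∃ g ∈ T, zygNorm β (fun z => K f z - g z) ≤ ε)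

/-- The essential norm of `uC_φ`, as an operator from the subspace of `B^α` cut out by
the predicate `P` into `Z_β`: the distance to the compact operators, the operator norm
being the supremum over the unit ball. -/
def essNormZ (α β : ℝ) (P : (ℂ → ℂ) → Prop) (u φ : ℂ → ℂ) : ℝ :=
  sInf {r | ∃ K, IsCompactOpToZygmund α β P K ∧
    r = sSup {s | ∃ f, P f ∧ blochNorm α f ≤ 1 ∧
          s = zygNorm β (fun z => wcomp u φ f z - K f z)}}

/-- A compact (linear, bounded, with totally bounded image of the unit ball) operator
from `B^α` into `H^∞_{ν_β}`. -/
def IsCompactOpToWeighted (α β : ℝ) (K : (ℂ → ℂ) → ℂ → ℂ) : Prop :=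
  (∀ f g, MemBloch α f → MemBloch α g → ∀ a b : ℂ,
      K (fun z => a * f z + b * g z) = fun z => a * K f z + b * K g z) ∧
  (∀ f, MemBloch α f → MemWeighted β (K f)) ∧
  (∃ C, ∀ f, MemBloch α f → wnorm β (K f) ≤ C * blochNorm α f) ∧
  (∀ ε : ℝ, 0 < ε → ∃ T : Finset (ℂ → ℂ), (∀ g ∈ T, MemWeighted β g) ∧
      ∀ f, MemBloch α f → blochNorm α f ≤ 1 → ∃ g ∈ T, wnorm β (fun z => K f z - g z) ≤ ε)

/-- The essential norm of `uC_φ : B^α → H^∞_{ν_β}`. -/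
def essNormW (α β : ℝ) (u φ : ℂ → ℂ) : ℝ :=
  sInf {r | ∃ K, IsCompactOpToWeighted α β K ∧
    r = sSup {s | ∃ f, MemBloch α f ∧ blochNorm α f ≤ 1 ∧
          s = wnorm β (fun z => wcomp u φ f z - K f z)}}

/-- `limsup_{|φ(z)|→1} F(z) = lim_{s→1⁻} sup {F z : z ∈ 𝔻, |φ z| > s}`.  Since the inner
supremum is nonincreasing in `s`, the limit equals the infimum over `s ∈ [0,1)`; note
that `Real.sSup ∅ = 0`, matching the convention that the value is `0` when
`{z : |φ z| > s}` is empty for some `s < 1`. -/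
def phiLimsup (φ : ℂ → ℂ) (F : ℂ → ℝ) : ℝ :=
  sInf ((fun s => sSup {y | ∃ z ∈ unitDisk, s < ‖φ z‖ ∧ y = F z}) '' Set.Ico (0:ℝ) 1)

lemma mem_unitDisk_iff {z : ℂ} : z ∈ unitDisk ↔ ‖z‖ < 1 := by
  simp [unitDisk]

lemma isOpen_unitDisk : IsOpen unitDisk := Metric.isOpen_ball

lemma one_sub_norm_sq_pos {z : ℂ} (hz : z ∈ unitDisk) : 0 < 1 - ‖z‖ ^ 2 := by
  have h1 := mem_unitDisk_iff.1 hz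
  have h0 := norm_nonneg z
  nlinarith

lemma weight_nonneg (γ : ℝ) {z : ℂ} (hz : z ∈ unitDisk) : 0 ≤ (1 - ‖z‖ ^ 2) ^ γ :=
  Real.rpow_nonneg (one_sub_norm_sq_pos hz).le γ

lemma le_wnorm {γ : ℝ} {g : ℂ → ℂ}
    (hg : BddAbove ((fun z => (1 - ‖z‖ ^ 2) ^ γ * ‖g z‖) '' unitDisk)) {z : ℂ}
    (hz : z ∈ unitDisk) : (1 - ‖z‖ ^ 2) ^ γ * ‖g z‖ ≤ wnorm γ g :=
  le_csSup hg ⟨z, hz, rfl⟩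

lemma wnorm_le {γ M : ℝ} {g : ℂ → ℂ} (hM : 0 ≤ M)
    (h : ∀ z ∈ unitDisk, (1 - ‖z‖ ^ 2) ^ γ * ‖g z‖ ≤ M) : wnorm γ g ≤ M := by
  refine Real.sSup_le ?_ hM
  rintro _ ⟨z, hz, rfl⟩
  exact h z hz

lemma wnorm_nonneg (γ : ℝ) (g : ℂ → ℂ) : 0 ≤ wnorm γ g := by
  refine Real.sSup_nonneg ?_
  rintro _ ⟨z, hz, rfl⟩
  exact mul_nonneg (weight_nonneg γ hz) (norm_nonneg _)

lemma bddAbove_weight_image {γ M : ℝ} {g : ℂ → ℂ}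
    (h : ∀ z ∈ unitDisk, (1 - ‖z‖ ^ 2) ^ γ * ‖g z‖ ≤ M) :
    BddAbove ((fun z => (1 - ‖z‖ ^ 2) ^ γ * ‖g z‖) '' unitDisk) := by
  refine ⟨M, ?_⟩
  rintro _ ⟨z, hz, rfl⟩
  exact h z hz

/-- A scaled family of weighted norms tends to zero once its pointwise bounds do, uniformly. -/
lemma tendsto_mul_wnorm_zero {β : ℝ} {c : ℕ → ℝ} {G : ℕ → ℂ → ℂ} (hc : ∀ n, 0 < c n)
    (h : ∀ ε : ℝ, 0 < ε → ∀ᶠ n in atTop, ∀ z ∈ unitDisk,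
      c n * ((1 - ‖z‖ ^ 2) ^ β * ‖G n z‖) ≤ ε) :
    Tendsto (fun n => c n * wnorm β (G n)) atTop (nhds 0) := by
  rw [Metric.tendsto_nhds]
  intro ε hε
  filter_upwards [h (ε / 2) (half_pos hε)] with n hn
  have h1 : wnorm β (G n) ≤ ε / 2 / c n := by
    refine wnorm_le (div_nonneg (half_pos hε).le (hc n).le) fun z hz => ?_
    rw [le_div_iff₀ (hc n), mul_comm]
    exact hn z hz
  rw [le_div_iff₀ (hc n), mul_comm] at h1
  rw [Real.dist_eq, sub_zero, abs_of_nonneg (mul_nonneg (hc n).le (wnorm_nonneg _ _))]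
  linarith

/-- The second derivative of `u · (g ∘ φ)`. -/
lemma deriv_deriv_wcomp {u φ g : ℂ → ℂ} (hu : DifferentiableOn ℂ u unitDisk)
    (hφd : DifferentiableOn ℂ φ unitDisk) (hφm : Set.MapsTo φ unitDisk unitDisk)
    (hg : DifferentiableOn ℂ g unitDisk) {z : ℂ} (hz : z ∈ unitDisk) :
    deriv (wcomp u φ g) z = deriv u z * g (φ z) + u z * (deriv φ z * deriv g (φ z)) ∧
    deriv (deriv (wcomp u φ g)) z = deriv (deriv u) z * g (φ z)
      + (2 * deriv u z * deriv φ z + u z * deriv (deriv φ) z) * deriv g (φ z)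
      + u z * deriv φ z ^ 2 * deriv (deriv g) (φ z) := by
  have D : ∀ {f : ℂ → ℂ}, DifferentiableOn ℂ f unitDisk → ∀ w ∈ unitDisk,
      HasDerivAt f (deriv f w) w := fun hf w hw =>
    (hf.differentiableAt (isOpen_unitDisk.mem_nhds hw)).hasDerivAt
  have hfirst : ∀ w ∈ unitDisk, deriv (wcomp u φ g) w
      = deriv u w * g (φ w) + u w * (deriv g (φ w) * deriv φ w) := fun w hw =>
    ((D hu w hw).mul ((D hg _ (hφm hw)).comp w (D hφd w hw))).deriv
  refine ⟨by rw [hfirst z hz]; ring, ?_⟩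
  have hev : deriv (wcomp u φ g) =ᶠ[nhds z]
      fun w => deriv u w * g (φ w) + u w * (deriv g (φ w) * deriv φ w) :=
    Filter.eventually_of_mem (isOpen_unitDisk.mem_nhds hz) hfirst
  have h2 := ((D (hu.deriv isOpen_unitDisk) z hz).mul
      ((D hg _ (hφm hz)).comp z (D hφd z hz))).add
    ((D hu z hz).mul (((D (hg.deriv isOpen_unitDisk) _ (hφm hz)).comp z (D hφd z hz)).mul
      (D (hφd.deriv isOpen_unitDisk) z hz)))
  rw [hev.deriv_eq]
  refine h2.deriv.trans ?_
  simp only [Function.comp_apply, Pi.mul_apply]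
  ring

lemma differentiableOn_wcomp {u φ g : ℂ → ℂ} (hu : DifferentiableOn ℂ u unitDisk)
    (hφd : DifferentiableOn ℂ φ unitDisk) (hφm : Set.MapsTo φ unitDisk unitDisk)
    (hg : DifferentiableOn ℂ g unitDisk) : DifferentiableOn ℂ (wcomp u φ g) unitDisk :=
  hu.mul (hg.comp hφd hφm)

lemma deriv_deriv_sub {f g : ℂ → ℂ} (hf : DifferentiableOn ℂ f unitDisk)
    (hg : DifferentiableOn ℂ g unitDisk) {z : ℂ} (hz : z ∈ unitDisk) :
    deriv (fun w => f w - g w) z = deriv f z - deriv g z ∧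
    deriv (deriv (fun w => f w - g w)) z = deriv (deriv f) z - deriv (deriv g) z := by
  have D : ∀ {f : ℂ → ℂ}, DifferentiableOn ℂ f unitDisk → ∀ w ∈ unitDisk,
      DifferentiableAt ℂ f w := fun hf w hw =>
    hf.differentiableAt (isOpen_unitDisk.mem_nhds hw)
  have hfirst : ∀ w ∈ unitDisk, deriv (fun w => f w - g w) w = deriv f w - deriv g w :=
    fun w hw => deriv_fun_sub (D hf w hw) (D hg w hw)
  refine ⟨hfirst z hz, ?_⟩
  have hev : deriv (fun w => f w - g w) =ᶠ[nhds z] fun w => deriv f w - deriv g w :=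
    Filter.eventually_of_mem (isOpen_unitDisk.mem_nhds hz) hfirst
  rw [hev.deriv_eq]
  exact deriv_fun_sub (D (hf.deriv isOpen_unitDisk) z hz) (D (hg.deriv isOpen_unitDisk) z hz)

lemma weight_mul_norm_le_of_deriv_deriv_sub {β ε : ℝ} {f g : ℂ → ℂ} (hf : MemZygmund β f)
    (hg : MemZygmund β g) (h : zygNorm β (fun z => f z - g z) ≤ ε) {z : ℂ}
    (hz : z ∈ unitDisk) :
    (1 - ‖z‖ ^ 2) ^ β * ‖deriv (deriv f) z - deriv (deriv g) z‖ ≤ ε := by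
  have hb : BddAbove ((fun z => (1 - ‖z‖ ^ 2) ^ β *
      ‖deriv (deriv (fun w => f w - g w)) z‖) '' unitDisk) := by
    refine bddAbove_weight_image (M := wnorm β (deriv (deriv f)) + wnorm β (deriv (deriv g)))
      fun w hw => ?_
    rw [(deriv_deriv_sub hf.1 hg.1 hw).2]
    calc _ ≤ (1 - ‖w‖ ^ 2) ^ β * (‖deriv (deriv f) w‖ + ‖deriv (deriv g) w‖) :=
          mul_le_mul_of_nonneg_left (norm_sub_le _ _) (weight_nonneg β hw)
      _ ≤ _ := by rw [mul_add]; exact add_le_add (le_wnorm hf.2 hw) (le_wnorm hg.2 hw)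
  have h1 := le_wnorm hb hz
  rw [(deriv_deriv_sub hf.1 hg.1 hz).2] at h1
  unfold zygNorm at h
  have h2 := norm_nonneg (f 0 - g 0)
  have h3 := norm_nonneg (deriv (fun w => f w - g w) 0)
  simp only at h
  linarith

/-- A compact `uC_φ` sends norm-bounded sequences whose image second derivatives vanish
pointwise in the limit to sequences whose second derivatives vanish in the weighted norm. -/
lemma CompactBlochToZygmund.eventually_weight_le {α β r : ℝ} {u φ : ℂ → ℂ}
    (hK : CompactBlochToZygmund α β u φ) {f : ℕ → ℂ → ℂ} (hf : ∀ n, MemBloch α (f n))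
    (hr : ∀ n, blochNorm α (f n) ≤ r)
    (h0 : ∀ z ∈ unitDisk,
      Tendsto (fun n => deriv (deriv (wcomp u φ (f n))) z) atTop (nhds 0))
    {ε : ℝ} (hε : 0 < ε) :
    ∀ᶠ n in atTop, ∀ z ∈ unitDisk,
      (1 - ‖z‖ ^ 2) ^ β * ‖deriv (deriv (wcomp u φ (f n))) z‖ ≤ ε := by
  obtain ⟨T, hT, hfT⟩ := hK.2 r (ε / 2) (half_pos hε)
  have key : ∀ᶠ n in atTop, ∀ g ∈ T,
      zygNorm β (fun z => wcomp u φ (f n) z - g z) ≤ ε / 2 →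
      ∀ z ∈ unitDisk, (1 - ‖z‖ ^ 2) ^ β * ‖deriv (deriv g) z‖ ≤ ε / 2 := by
    rw [Finset.eventually_all]
    intro g hg
    by_cases hgood : ∀ z ∈ unitDisk, (1 - ‖z‖ ^ 2) ^ β * ‖deriv (deriv g) z‖ ≤ ε / 2
    · exact Eventually.of_forall fun _ _ => hgood
    · push Not at hgood
      obtain ⟨z, hz, hlt⟩ := hgood
      have hlim : Tendsto (fun n => (1 - ‖z‖ ^ 2) ^ β *
          ‖deriv (deriv (wcomp u φ (f n))) z - deriv (deriv g) z‖) atTop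
          (nhds ((1 - ‖z‖ ^ 2) ^ β * ‖0 - deriv (deriv g) z‖)) :=
        (((h0 z hz).sub_const _).norm).const_mul _
      rw [zero_sub, norm_neg] at hlim
      filter_upwards [hlim.eventually_const_lt hlt] with n hn hclose
      exact absurd (weight_mul_norm_le_of_deriv_deriv_sub (hK.1.1 _ (hf n)) (hT g hg) hclose hz)
        (not_le.2 hn)
  filter_upwards [key] with n hn z hz
  obtain ⟨g, hg, hclose⟩ := hfT (f n) (hf n) (hr n)
  have h1 := weight_mul_norm_le_of_deriv_deriv_sub (hK.1.1 _ (hf n)) (hT g hg) hclose hz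
  have h2 := hn g hg hclose z hz
  calc _ ≤ (1 - ‖z‖ ^ 2) ^ β * (‖deriv (deriv (wcomp u φ (f n))) z - deriv (deriv g) z‖
        + ‖deriv (deriv g) z‖) := by
        refine mul_le_mul_of_nonneg_left ?_ (weight_nonneg β hz)
        simpa using norm_add_le (deriv (deriv (wcomp u φ (f n))) z - deriv (deriv g) z)
          (deriv (deriv g) z)
    _ ≤ ε := by rw [mul_add]; linarith

lemma deriv_const_mul_pow (c : ℂ) (n : ℕ) :
    deriv (fun z : ℂ => c * z ^ n) = fun z => c * n * z ^ (n - 1) := by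
  funext z
  rw [((hasDerivAt_pow n z).const_mul c).deriv]
  ring

lemma deriv_deriv_const_mul_pow (c : ℂ) (n : ℕ) :
    deriv (deriv (fun z : ℂ => c * z ^ n)) = fun z => c * n * (n - 1 : ℕ) * z ^ (n - 1 - 1) := by
  rw [deriv_const_mul_pow, deriv_const_mul_pow]

lemma nat_mul_pow_mul_one_sub_le {x : ℝ} (hx0 : 0 ≤ x) (hx1 : x ≤ 1) (n : ℕ) :
    ((n : ℝ) + 1) * x ^ n * (1 - x) ≤ 1 := by
  have h1 : ((n : ℝ) + 1) * x ^ n ≤ ∑ i ∈ Finset.range (n + 1), x ^ i := by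
    have := Finset.card_nsmul_le_sum (Finset.range (n + 1)) (fun i => x ^ i) (x ^ n)
      (fun i hi => pow_le_pow_of_le_one hx0 hx1 (Nat.lt_succ_iff.1 (Finset.mem_range.1 hi)))
    simpa using this
  have h2 := mul_geom_sum x (n + 1)
  have h3 := pow_nonneg hx0 (n + 1)
  have h4 : 0 ≤ 1 - x := by linarith
  nlinarith [mul_le_mul_of_nonneg_right h1 h4]

lemma rpow_weight_mul_pow_le {α x : ℝ} (hα0 : 0 < α) (hα1 : α < 1) (hx0 : 0 ≤ x) (hx1 : x < 1)
    (n : ℕ) : (1 - x ^ 2) ^ α * (((n : ℝ) + 1) ^ α * x ^ n) ≤ 2 := by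
  have hxn := pow_nonneg hx0 n
  have hxn1 : x ^ n ≤ 1 := pow_le_one₀ hx0 hx1.le
  have h1 : x ^ n ≤ (x ^ n) ^ α := by
    simpa using Real.rpow_le_rpow_of_exponent_ge_of_imp hxn hxn1 hα1.le
      (fun _ h => absurd h one_ne_zero)
  have h2 : (1 - x ^ 2) ^ α * (((n : ℝ) + 1) ^ α * (x ^ n) ^ α) ≤ 2 := by
    rw [← Real.mul_rpow (by positivity) hxn, ← Real.mul_rpow (by nlinarith) (by positivity)]
    have h3 : (1 - x ^ 2) * (((n : ℝ) + 1) * x ^ n) ≤ 2 := by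
      have := nat_mul_pow_mul_one_sub_le hx0 hx1.le n
      have h4 : (1 - x ^ 2) * (((n : ℝ) + 1) * x ^ n)
        = (1 + x) * (((n : ℝ) + 1) * x ^ n * (1 - x)) := by ring
      rw [h4]
      nlinarith
    have h0 : 0 ≤ (1 - x ^ 2) * (((n : ℝ) + 1) * x ^ n) :=
      mul_nonneg (by nlinarith) (by positivity)
    calc _ ≤ (2 : ℝ) ^ α := Real.rpow_le_rpow h0 h3 hα0.le
      _ ≤ 2 ^ (1 : ℝ) := Real.rpow_le_rpow_of_exponent_le (by norm_num) hα1.le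
      _ = 2 := Real.rpow_one 2
  refine le_trans ?_ h2
  have : 0 ≤ (1 - x ^ 2) ^ α := Real.rpow_nonneg (by nlinarith) _
  gcongr

lemma memBloch_pow {α : ℝ} (hα0 : 0 < α) (hα1 : α < 1) (n : ℕ) :
    MemBloch α (fun z => (((n : ℝ) + 1) ^ (α - 1) : ℝ) * z ^ (n + 1)) ∧
    blochNorm α (fun z => (((n : ℝ) + 1) ^ (α - 1) : ℝ) * z ^ (n + 1)) ≤ 2 := by
  have hb : ∀ z ∈ unitDisk, (1 - ‖z‖ ^ 2) ^ α *
      ‖deriv (fun z : ℂ => (((n : ℝ) + 1) ^ (α - 1) : ℝ) * z ^ (n + 1)) z‖ ≤ 2 := by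
    intro z hz
    refine le_trans (le_of_eq ?_)
      (rpow_weight_mul_pow_le hα0 hα1 (norm_nonneg z) (mem_unitDisk_iff.1 hz) n)
    rw [deriv_const_mul_pow]
    have hn : (0 : ℝ) < (n : ℝ) + 1 := by positivity
    have h1 : ‖((n + 1 : ℕ) : ℂ)‖ = (n : ℝ) + 1 := by
      rw [Complex.norm_natCast]; push_cast; ring
    rw [norm_mul, norm_mul, norm_pow, h1, Complex.norm_real, Real.norm_eq_abs,
      abs_of_nonneg (by positivity)]
    have h2 : ((n : ℝ) + 1) ^ (α - 1) * ((n : ℝ) + 1) = ((n : ℝ) + 1) ^ α := by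
      rw [← Real.rpow_add_one hn.ne']; ring_nf
    rw [h2, Nat.add_sub_cancel]
  refine ⟨⟨by fun_prop, bddAbove_weight_image hb⟩, ?_⟩
  unfold blochNorm
  have := wnorm_le zero_le_two hb
  simpa using this

lemma memBloch_const_mul_pow {α : ℝ} (hα0 : 0 < α) (c : ℂ) (n : ℕ) :
    MemBloch α (fun z => c * z ^ n) := by
  refine ⟨by fun_prop, bddAbove_weight_image (M := ‖c‖ * n) fun z hz => ?_⟩
  rw [deriv_const_mul_pow, norm_mul, norm_mul, norm_pow, Complex.norm_natCast]
  have h1 : (1 - ‖z‖ ^ 2) ^ α ≤ 1 :=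
    Real.rpow_le_one (one_sub_norm_sq_pos hz).le (by nlinarith [norm_nonneg z]) hα0.le
  have h2 : ‖z‖ ^ (n - 1) ≤ 1 := pow_le_one₀ (norm_nonneg z) (mem_unitDisk_iff.1 hz).le
  calc _ ≤ 1 * (‖c‖ * n * 1) := by
        gcongr
    _ = _ := by ring

/-- Boundedness of `uC_φ`, tested on `1`, `z` and `z²`, bounds its three coefficients. -/
lemma BoundedBlochToZygmund.exists_coeff_bound {α β : ℝ} (hα0 : 0 < α) {u φ : ℂ → ℂ}
    (hu : DifferentiableOn ℂ u unitDisk) (hφd : DifferentiableOn ℂ φ unitDisk)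
    (hφm : Set.MapsTo φ unitDisk unitDisk) (hB : BoundedBlochToZygmund α β u φ) :
    ∃ K : ℝ, 0 ≤ K ∧ ∀ z ∈ unitDisk,
      (1 - ‖z‖ ^ 2) ^ β * ‖deriv (deriv u) z‖ ≤ K ∧
      (1 - ‖z‖ ^ 2) ^ β * ‖2 * deriv u z * deriv φ z + u z * deriv (deriv φ) z‖ ≤ K ∧
      (1 - ‖z‖ ^ 2) ^ β * ‖u z * deriv φ z ^ 2‖ ≤ K := by
  have hmem : ∀ n : ℕ, ∃ K : ℝ, ∀ z ∈ unitDisk, (1 - ‖z‖ ^ 2) ^ β *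
      ‖deriv (deriv u) z * φ z ^ n
      + (2 * deriv u z * deriv φ z + u z * deriv (deriv φ) z) * (n * φ z ^ (n - 1))
      + u z * deriv φ z ^ 2 * (n * (n - 1 : ℕ) * φ z ^ (n - 1 - 1))‖ ≤ K := by
    intro n
    refine ⟨_, fun z hz => le_trans (le_of_eq ?_)
      (le_wnorm (hB.1 _ (memBloch_const_mul_pow hα0 1 n)).2 hz)⟩
    rw [(deriv_deriv_wcomp hu hφd hφm (by fun_prop) hz).2, deriv_deriv_const_mul_pow,
      deriv_const_mul_pow]
    simp only [one_mul]
  obtain ⟨K0, h0⟩ := hmem 0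
  obtain ⟨K1, h1⟩ := hmem 1
  obtain ⟨K2, h2⟩ := hmem 2
  have key : ∀ z ∈ unitDisk,
      (1 - ‖z‖ ^ 2) ^ β * ‖deriv (deriv u) z‖ ≤ K0 ∧
      (1 - ‖z‖ ^ 2) ^ β * ‖2 * deriv u z * deriv φ z + u z * deriv (deriv φ) z‖ ≤ K1 + K0 ∧
      (1 - ‖z‖ ^ 2) ^ β * ‖u z * deriv φ z ^ 2‖ ≤ K2 + K0 + 2 * (K1 + K0) := by
    intro z hz
    have hw := weight_nonneg β hz
    have hφ := (mem_unitDisk_iff.1 (hφm hz)).le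
    have e0 := h0 z hz
    have e1 := h1 z hz
    have e2 := h2 z hz
    norm_num at e0 e1 e2
    generalize hA : 2 * deriv u z * deriv φ z + u z * deriv (deriv φ) z = A at *
    generalize hC : u z * deriv φ z ^ 2 = C at *
    generalize deriv (deriv u) z = v at *
    generalize (1 - ‖z‖ ^ 2) ^ β = w at *
    have a1 : ‖A‖ ≤ ‖v * φ z + A‖ + ‖v‖ := by
      calc ‖A‖ = ‖(v * φ z + A) - v * φ z‖ := by congr 1; ring
        _ ≤ ‖v * φ z + A‖ + ‖v * φ z‖ := norm_sub_le _ _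
        _ ≤ _ := by
          rw [norm_mul]
          have := mul_le_of_le_one_right (norm_nonneg v) hφ
          linarith
    have a2 : ‖C‖ ≤ ‖v * φ z ^ 2 + A * (2 * φ z) + C * 2‖ + ‖v‖ + 2 * ‖A‖ := by
      have hv : ‖v * φ z ^ 2‖ ≤ ‖v‖ := by
        rw [norm_mul, norm_pow]
        exact mul_le_of_le_one_right (norm_nonneg v) (pow_le_one₀ (norm_nonneg _) hφ)
      have hA2 : ‖A * (2 * φ z)‖ ≤ 2 * ‖A‖ := by
        rw [norm_mul, norm_mul, Complex.norm_two]
        nlinarith [norm_nonneg A]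
      have h2C : ‖C * 2‖ = 2 * ‖C‖ := by rw [norm_mul, Complex.norm_two, mul_comm]
      have h3 : ‖C * 2‖ ≤ ‖v * φ z ^ 2 + A * (2 * φ z) + C * 2‖ + ‖v * φ z ^ 2‖
          + ‖A * (2 * φ z)‖ := by
        calc ‖C * 2‖ = ‖(v * φ z ^ 2 + A * (2 * φ z) + C * 2) - v * φ z ^ 2
              - A * (2 * φ z)‖ := by congr 1; ring
          _ ≤ _ := (norm_sub_le _ _).trans (add_le_add_left (norm_sub_le _ _) _)
      linarith [norm_nonneg C]
    have b1 := mul_le_mul_of_nonneg_left a1 hw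
    have b2 := mul_le_mul_of_nonneg_left a2 hw
    refine ⟨e0, ?_, ?_⟩ <;> nlinarith
  refine ⟨max 0 (max K0 (max (K1 + K0) (K2 + K0 + 2 * (K1 + K0)))), le_max_left _ _,
    fun z hz => ?_⟩
  obtain ⟨k0, k1, k2⟩ := key z hz
  refine ⟨k0.trans ?_, k1.trans ?_, k2.trans ?_⟩ <;> simp

/-- Along `|φ z| → 1`, a coefficient `G` with `(n+1)^a ‖G φ^n‖ → 0` is dominated by
`(1 - |φ z|)^a`. -/
lemma exists_weight_le_one_sub_rpow {a β K : ℝ} (ha : 0 ≤ a) {φ G : ℂ → ℂ}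
    (hφm : Set.MapsTo φ unitDisk unitDisk)
    (hG : ∀ z ∈ unitDisk, (1 - ‖z‖ ^ 2) ^ β * ‖G z‖ ≤ K)
    (hlim : Tendsto (fun n : ℕ => ((n : ℝ) + 1) ^ a * wnorm β (fun z => G z * φ z ^ n))
      atTop (nhds 0)) {ε : ℝ} (hε : 0 < ε) :
    ∃ ρ : ℝ, 0 ≤ ρ ∧ ρ < 1 ∧ ∀ z ∈ unitDisk, ρ < ‖φ z‖ →
      (1 - ‖z‖ ^ 2) ^ β * ‖G z‖ ≤ ε * (1 - ‖φ z‖) ^ a := by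
  have h2a : (0 : ℝ) < 2 ^ a := by positivity
  obtain ⟨N, hN⟩ := eventually_atTop.1
    (hlim.eventually_le_const (show 0 < ε / (2 * 2 ^ a) by positivity))
  have hN1 : (0 : ℝ) < 2 * ((N : ℝ) + 1) := by positivity
  refine ⟨1 - 1 / (2 * ((N : ℝ) + 1)), ?_, ?_, ?_⟩
  · rw [sub_nonneg, div_le_one hN1]
    have : (0 : ℝ) ≤ N := N.cast_nonneg
    linarith
  · have : 0 < 1 / (2 * ((N : ℝ) + 1)) := by positivity
    linarith
  intro z hz hρ
  have ht1 := mem_unitDisk_iff.1 (hφm hz)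
  have hw := weight_nonneg β hz
  set t := ‖φ z‖ with ht
  have ht0 : 0 ≤ t := norm_nonneg _
  have hd : 0 < 1 - t := by linarith
  have hx0 : 0 < 1 / (2 * (1 - t)) := by positivity
  set n := ⌊1 / (2 * (1 - t))⌋₊ with hn
  have hn1 : (n : ℝ) ≤ 1 / (2 * (1 - t)) := Nat.floor_le hx0.le
  have hn2 : 1 / (2 * (1 - t)) < n + 1 := Nat.lt_floor_add_one _
  have hNn : N ≤ n := by
    refine Nat.le_floor ?_
    rw [le_div_iff₀ (by positivity)]
    have h1 : 1 - t < 1 / (2 * ((N : ℝ) + 1)) := by linarith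
    rw [lt_div_iff₀ hN1] at h1
    nlinarith
  have hnt : 1 / 2 ≤ t ^ n := by
    have h1 := one_add_mul_le_pow (show (-2 : ℝ) ≤ -(1 - t) by linarith) n
    rw [show 1 + -(1 - t) = t by ring] at h1
    rw [le_div_iff₀ (by positivity)] at hn1
    nlinarith
  have hpow : 1 ≤ 2 ^ a * (((n : ℝ) + 1) ^ a * (1 - t) ^ a) := by
    rw [← Real.mul_rpow (by positivity) hd.le, ← Real.mul_rpow (by norm_num) (by positivity)]
    refine Real.one_le_rpow ?_ ha
    rw [div_lt_iff₀ (by positivity)] at hn2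
    linarith
  have hbdd : BddAbove ((fun z => (1 - ‖z‖ ^ 2) ^ β * ‖G z * φ z ^ n‖) '' unitDisk) := by
    refine bddAbove_weight_image (M := K) fun w hw => le_trans ?_ (hG w hw)
    refine mul_le_mul_of_nonneg_left ?_ (weight_nonneg β hw)
    rw [norm_mul, norm_pow]
    exact mul_le_of_le_one_right (norm_nonneg _)
      (pow_le_one₀ (norm_nonneg _) (mem_unitDisk_iff.1 (hφm hw)).le)
  have hle := le_wnorm hbdd hz
  rw [norm_mul, norm_pow, ← ht] at hle
  have hNε := hN n hNn
  set X := (1 - ‖z‖ ^ 2) ^ β * ‖G z‖ with hX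
  have hX0 : 0 ≤ X := mul_nonneg hw (norm_nonneg _)
  have h1 : X ≤ 2 * wnorm β (fun z => G z * φ z ^ n) := by
    have : X * (1 / 2) ≤ X * t ^ n := mul_le_mul_of_nonneg_left hnt hX0
    rw [← mul_assoc, ← hX] at hle
    linarith
  have h2 : X ≤ X * (2 ^ a * (((n : ℝ) + 1) ^ a * (1 - t) ^ a)) :=
    le_mul_of_one_le_right hX0 hpow
  have hq : 0 ≤ 2 ^ a * (((n : ℝ) + 1) ^ a * (1 - t) ^ a) := by linarith
  calc X ≤ _ := h2
    _ ≤ 2 * wnorm β (fun z => G z * φ z ^ n) * (2 ^ a * (((n : ℝ) + 1) ^ a * (1 - t) ^ a)) :=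
        mul_le_mul_of_nonneg_right h1 hq
    _ = (2 * 2 ^ a) * (((n : ℝ) + 1) ^ a * wnorm β (fun z => G z * φ z ^ n)) * (1 - t) ^ a := by
        ring
    _ ≤ (2 * 2 ^ a) * (ε / (2 * 2 ^ a)) * (1 - t) ^ a := by
        gcongr
    _ = ε * (1 - t) ^ a := by
        field_simp

/-- Compactness controls the monomial test functions: the `φ^n`-weighted combination of the
two non-trivial coefficients of `(u · f ∘ φ)''` is `o(n^{-α})`. -/
lemma CompactBlochToZygmund.eventually_pow_combination_le {α β : ℝ} (hα0 : 0 < α) (hα1 : α < 1)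
    {u φ : ℂ → ℂ} (hu : DifferentiableOn ℂ u unitDisk) (hφd : DifferentiableOn ℂ φ unitDisk)
    (hφm : Set.MapsTo φ unitDisk unitDisk) (hK : CompactBlochToZygmund α β u φ)
    {ε : ℝ} (hε : 0 < ε) :
    ∀ᶠ n : ℕ in atTop, ∀ z ∈ unitDisk,
      ((n : ℝ) + 2) ^ α * ((1 - ‖z‖ ^ 2) ^ β *
        ‖φ z ^ n * ((2 * deriv u z * deriv φ z + u z * deriv (deriv φ) z) * φ z
          + (n + 1) * (u z * deriv φ z ^ 2))‖) ≤ ε := by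
  obtain ⟨K, hK0, hcoeff⟩ := hK.1.exists_coeff_bound hα0 hu hφd hφm
  set c : ℕ → ℝ := fun n => (((n + 1 : ℕ) : ℝ) + 1) ^ (α - 1) with hcdef
  have hc0 : ∀ n, 0 ≤ c n := fun n => by positivity
  have hc1 : ∀ n, c n ≤ 1 := fun n =>
    Real.rpow_le_one_of_one_le_of_nonpos (by norm_cast; omega) (by linarith)
  have hcα : ∀ n : ℕ, c n * ((n : ℝ) + 2) = ((n : ℝ) + 2) ^ α := by
    intro n
    have h2 : (((n + 1 : ℕ) : ℝ) + 1) = (n : ℝ) + 2 := by push_cast; ring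
    rw [hcdef]
    simp only [h2]
    rw [← Real.rpow_add_one (by positivity)]
    ring_nf
  set D : ℕ → ℂ → ℂ := fun n z =>
    φ z ^ n * ((2 * deriv u z * deriv φ z + u z * deriv (deriv φ) z) * φ z
      + (n + 1) * (u z * deriv φ z ^ 2)) with hD
  set f : ℕ → ℂ → ℂ := fun n z => (c n : ℝ) * z ^ (n + 1 + 1) with hf
  have hformula : ∀ n : ℕ, ∀ z ∈ unitDisk, deriv (deriv (wcomp u φ (f n))) z
      = c n * (deriv (deriv u) z * φ z ^ (n + 2)) + (c n * (n + 2)) * D n z := by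
    intro n z hz
    rw [(deriv_deriv_wcomp hu hφd hφm (by fun_prop) hz).2, deriv_deriv_const_mul_pow,
      deriv_const_mul_pow]
    simp only [hD, hf, Nat.add_sub_cancel]
    push_cast
    ring
  have hlim : ∀ z ∈ unitDisk,
      Tendsto (fun n => deriv (deriv (wcomp u φ (f n))) z) atTop (nhds 0) := by
    intro z hz
    have hq1 := mem_unitDisk_iff.1 (hφm hz)
    have hq0 := norm_nonneg (φ z)
    have hpow := fun k : ℕ => tendsto_pow_const_mul_const_pow_of_abs_lt_one k
      (show |‖φ z‖| < 1 by rwa [abs_of_nonneg hq0])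
    have hsum := (((hpow 2).add ((hpow 1).const_mul 4)).add ((hpow 0).const_mul 4)).const_mul
      (‖deriv (deriv u) z‖ + (‖2 * deriv u z * deriv φ z + u z * deriv (deriv φ) z‖
        + ‖u z * deriv φ z ^ 2‖))
    simp only [mul_zero, add_zero] at hsum
    refine squeeze_zero_norm (fun n => ?_) hsum
    rw [hformula n z hz]
    simp only [hD]
    generalize 2 * deriv u z * deriv φ z + u z * deriv (deriv φ) z = A
    generalize u z * deriv φ z ^ 2 = C
    generalize deriv (deriv u) z = v
    have hcn : ‖(c n : ℂ)‖ ≤ 1 := by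
      rw [Complex.norm_real, Real.norm_eq_abs, abs_of_nonneg (hc0 n)]; exact hc1 n
    have hn1 : ‖(n : ℂ) + 1‖ = n + 1 := by
      rw [show (n : ℂ) + 1 = ((n + 1 : ℕ) : ℂ) by push_cast; rfl, Complex.norm_natCast]
      push_cast; rfl
    have hn2 : ‖(n : ℂ) + 2‖ = n + 2 := by
      rw [show (n : ℂ) + 2 = ((n + 2 : ℕ) : ℂ) by push_cast; rfl, Complex.norm_natCast]
      push_cast; rfl
    have hqn : 0 ≤ ‖φ z‖ ^ n := pow_nonneg hq0 n
    have t1 : ‖(c n : ℂ) * (v * φ z ^ (n + 2))‖ ≤ ((n : ℝ) + 2) ^ 2 * ‖φ z‖ ^ n * ‖v‖ := by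
      rw [norm_mul, norm_mul, norm_pow]
      calc _ ≤ 1 * (‖v‖ * ‖φ z‖ ^ n) := by
            gcongr ?_ * (_ * ?_)
            exact pow_le_pow_of_le_one hq0 hq1.le (by omega)
        _ = 1 * (‖φ z‖ ^ n * ‖v‖) := by ring
        _ ≤ ((n : ℝ) + 2) ^ 2 * (‖φ z‖ ^ n * ‖v‖) := by
            gcongr
            have : (0 : ℝ) ≤ n := n.cast_nonneg
            nlinarith
        _ = _ := by ring
    have t2 : ‖(c n : ℂ) * (n + 2) * (φ z ^ n * (A * φ z + (n + 1) * C))‖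
        ≤ ((n : ℝ) + 2) ^ 2 * ‖φ z‖ ^ n * (‖A‖ + ‖C‖) := by
      rw [norm_mul, norm_mul, norm_mul, norm_pow, hn2]
      have h3 : ‖A * φ z + (n + 1) * C‖ ≤ ((n : ℝ) + 2) * (‖A‖ + ‖C‖) := by
        refine (norm_add_le _ _).trans ?_
        rw [norm_mul, norm_mul, hn1]
        have h4 : ‖A‖ * ‖φ z‖ ≤ ‖A‖ := mul_le_of_le_one_right (norm_nonneg _) hq1.le
        have : (0 : ℝ) ≤ n := n.cast_nonneg
        nlinarith [norm_nonneg A, norm_nonneg C]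
      calc _ ≤ 1 * ((n : ℝ) + 2) * (‖φ z‖ ^ n * (((n : ℝ) + 2) * (‖A‖ + ‖C‖))) := by
            gcongr
        _ = _ := by ring
    refine (norm_add_le _ _).trans ((add_le_add t1 t2).trans (le_of_eq ?_))
    ring
  have hmain := hK.eventually_weight_le (f := f) (r := 2)
    (fun n => (memBloch_pow hα0 hα1 (n + 1)).1) (fun n => (memBloch_pow hα0 hα1 (n + 1)).2)
    hlim (half_pos hε)
  have hsmall : Tendsto (fun n => c n * K) atTop (nhds 0) := by
    have h1 : Tendsto (fun x : ℝ => x ^ (α - 1)) atTop (nhds 0) := by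
      simpa using tendsto_rpow_neg_atTop (show 0 < 1 - α by linarith)
    have h2 : Tendsto (fun n : ℕ => ((n + 1 : ℕ) : ℝ) + 1) atTop atTop :=
      tendsto_atTop_add_const_right _ _
        (tendsto_natCast_atTop_atTop.comp (tendsto_add_atTop_nat 1))
    have h3 := (h1.comp h2).mul_const K
    rwa [zero_mul] at h3
  filter_upwards [hmain, hsmall.eventually_le_const (half_pos hε)] with n hn hnK z hz
  have h1 := hn z hz
  have hw := weight_nonneg β hz
  rw [hformula n z hz] at h1
  have hv : (1 - ‖z‖ ^ 2) ^ β * ‖(c n : ℂ) * (deriv (deriv u) z * φ z ^ (n + 2))‖ ≤ ε / 2 := by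
    rw [norm_mul, norm_mul, norm_pow, Complex.norm_real, Real.norm_eq_abs,
      abs_of_nonneg (hc0 n)]
    calc _ ≤ (1 - ‖z‖ ^ 2) ^ β * (c n * (‖deriv (deriv u) z‖ * 1)) := by
          have := hc0 n
          gcongr
          exact pow_le_one₀ (norm_nonneg _) (mem_unitDisk_iff.1 (hφm hz)).le
      _ = c n * ((1 - ‖z‖ ^ 2) ^ β * ‖deriv (deriv u) z‖) := by ring
      _ ≤ c n * K := mul_le_mul_of_nonneg_left (hcoeff z hz).1 (hc0 n)
      _ ≤ ε / 2 := hnK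
  have hnorm : ‖(c n : ℂ) * (n + 2) * D n z‖ = ((n : ℝ) + 2) ^ α * ‖D n z‖ := by
    rw [norm_mul, ← hcα n]
    congr 1
    rw [show (c n : ℂ) * (n + 2) = ((c n * (n + 2) : ℝ) : ℂ) by push_cast; rfl,
      Complex.norm_real, Real.norm_eq_abs, abs_of_nonneg (mul_nonneg (hc0 n) (by positivity))]
  have htri : ‖(c n : ℂ) * (n + 2) * D n z‖ ≤
      ‖(c n : ℂ) * (deriv (deriv u) z * φ z ^ (n + 2)) + (c n : ℂ) * (n + 2) * D n z‖
      + ‖(c n : ℂ) * (deriv (deriv u) z * φ z ^ (n + 2))‖ := by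
    simpa using norm_sub_le
      ((c n : ℂ) * (deriv (deriv u) z * φ z ^ (n + 2)) + (c n : ℂ) * (n + 2) * D n z)
      ((c n : ℂ) * (deriv (deriv u) z * φ z ^ (n + 2)))
  have h2 := mul_le_mul_of_nonneg_left htri hw
  rw [hnorm] at h2
  change ((n : ℝ) + 2) ^ α * ((1 - ‖z‖ ^ 2) ^ β * ‖D n z‖) ≤ ε
  linarith

lemma CompactBlochToZygmund.eventually_square_coeff_le {α β : ℝ} (hα0 : 0 < α) (hα1 : α < 1)
    {u φ : ℂ → ℂ} (hu : DifferentiableOn ℂ u unitDisk) (hφd : DifferentiableOn ℂ φ unitDisk)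
    (hφm : Set.MapsTo φ unitDisk unitDisk) (hK : CompactBlochToZygmund α β u φ)
    {ε : ℝ} (hε : 0 < ε) :
    ∀ᶠ n : ℕ in atTop, ∀ z ∈ unitDisk,
      ((n : ℝ) + 1) ^ (α + 1) * ((1 - ‖z‖ ^ 2) ^ β * ‖u z * deriv φ z ^ 2 * φ z ^ n‖) ≤ ε := by
  obtain ⟨N, hN⟩ := eventually_atTop.1 (hK.eventually_pow_combination_le hα0 hα1 hu hφd hφm
    (show 0 < ε / 16 by positivity))
  filter_upwards [eventually_ge_atTop (2 * N + 2)] with k hk z hz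
  have hw := weight_nonneg β hz
  have hq1 := (mem_unitDisk_iff.1 (hφm hz)).le
  have hq0 := norm_nonneg (φ z)
  obtain ⟨n, hn2, hkn⟩ : ∃ n : ℕ, 2 * n ≤ k ∧ k ≤ 2 * n + 1 := ⟨k / 2, by omega, by omega⟩
  have hnN : N ≤ n := by omega
  have hn1 : 1 ≤ n := by omega
  have e1 := hN n hnN z hz
  have e2 := hN (n + n) (by omega) z hz
  generalize 2 * deriv u z * deriv φ z + u z * deriv (deriv φ) z = A at *
  generalize u z * deriv φ z ^ 2 = C at *
  set w := (1 - ‖z‖ ^ 2) ^ β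
  set D1 := φ z ^ n * (A * φ z + (n + 1) * C)
  set D2 := φ z ^ (n + n) * (A * φ z + ((n + n : ℕ) + 1) * C) with hD2
  have hnR : (1 : ℝ) ≤ n := by exact_mod_cast hn1
  have hpos : 0 < ((n : ℝ) + 2) ^ α := by positivity
  have e2' : ((n : ℝ) + 2) ^ α * (w * ‖D2‖) ≤ ε / 16 := by
    refine le_trans ?_ e2
    refine mul_le_mul_of_nonneg_right ?_ (mul_nonneg hw (norm_nonneg _))
    refine Real.rpow_le_rpow (by positivity) ?_ hα0.le
    push_cast
    linarith
  have hdiff : (n : ℝ) * ‖C * φ z ^ k‖ ≤ ‖D2‖ + ‖D1‖ := by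
    have h1 : ‖C * φ z ^ k‖ ≤ ‖C * φ z ^ (n + n)‖ := by
      rw [norm_mul, norm_mul, norm_pow, norm_pow]
      exact mul_le_mul_of_nonneg_left (pow_le_pow_of_le_one hq0 hq1 (by omega)) (norm_nonneg _)
    have h2 : (n : ℂ) * (C * φ z ^ (n + n)) = D2 - φ z ^ n * D1 := by
      simp only [D1, D2]
      push_cast
      ring
    have h3 : ‖φ z ^ n * D1‖ ≤ ‖D1‖ := by
      rw [norm_mul, norm_pow]
      exact mul_le_of_le_one_left (norm_nonneg _) (pow_le_one₀ hq0 hq1)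
    have h4 : (n : ℝ) * ‖C * φ z ^ (n + n)‖ = ‖(n : ℂ) * (C * φ z ^ (n + n))‖ := by
      rw [norm_mul (n : ℂ), Complex.norm_natCast]
    calc _ ≤ (n : ℝ) * ‖C * φ z ^ (n + n)‖ := by gcongr
      _ = ‖D2 - φ z ^ n * D1‖ := by rw [h4, h2]
      _ ≤ ‖D2‖ + ‖φ z ^ n * D1‖ := norm_sub_le _ _
      _ ≤ _ := by gcongr
  have hk1 : (k : ℝ) + 1 ≤ 2 * ((n : ℝ) + 2) := by
    have : (k : ℝ) ≤ 2 * n + 1 := by exact_mod_cast hkn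
    linarith
  have hk2 : (k : ℝ) + 1 ≤ 4 * (n : ℝ) := by
    have : (k : ℝ) ≤ 2 * n + 1 := by exact_mod_cast hkn
    linarith
  have hkα : ((k : ℝ) + 1) ^ α ≤ 2 * ((n : ℝ) + 2) ^ α := by
    calc ((k : ℝ) + 1) ^ α ≤ (2 * ((n : ℝ) + 2)) ^ α :=
          Real.rpow_le_rpow (by positivity) hk1 hα0.le
      _ = 2 ^ α * ((n : ℝ) + 2) ^ α := Real.mul_rpow (by norm_num) (by positivity)
      _ ≤ 2 ^ (1 : ℝ) * ((n : ℝ) + 2) ^ α := by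
          gcongr
          norm_num
      _ = _ := by rw [Real.rpow_one]
  have hwC : 0 ≤ w * ‖C * φ z ^ k‖ := mul_nonneg hw (norm_nonneg _)
  rw [Real.rpow_add_one (by positivity)]
  calc ((k : ℝ) + 1) ^ α * ((k : ℝ) + 1) * (w * ‖C * φ z ^ k‖)
      ≤ 2 * ((n : ℝ) + 2) ^ α * (4 * (n : ℝ)) * (w * ‖C * φ z ^ k‖) := by gcongr
    _ = 8 * (((n : ℝ) + 2) ^ α * (w * ((n : ℝ) * ‖C * φ z ^ k‖))) := by ring
    _ ≤ 8 * (((n : ℝ) + 2) ^ α * (w * (‖D2‖ + ‖D1‖))) := by gcongr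
    _ = 8 * (((n : ℝ) + 2) ^ α * (w * ‖D2‖) + ((n : ℝ) + 2) ^ α * (w * ‖D1‖)) := by ring
    _ ≤ ε := by linarith

lemma CompactBlochToZygmund.eventually_linear_coeff_le {α β : ℝ} (hα0 : 0 < α) (hα1 : α < 1)
    {u φ : ℂ → ℂ} (hu : DifferentiableOn ℂ u unitDisk) (hφd : DifferentiableOn ℂ φ unitDisk)
    (hφm : Set.MapsTo φ unitDisk unitDisk) (hK : CompactBlochToZygmund α β u φ)
    {ε : ℝ} (hε : 0 < ε) :
    ∀ᶠ n : ℕ in atTop, ∀ z ∈ unitDisk,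
      ((n : ℝ) + 1) ^ α * ((1 - ‖z‖ ^ 2) ^ β *
        ‖(2 * deriv u z * deriv φ z + u z * deriv (deriv φ) z) * φ z ^ n‖) ≤ ε := by
  obtain ⟨N, hN⟩ := eventually_atTop.1
    ((hK.eventually_pow_combination_le hα0 hα1 hu hφd hφm (half_pos hε)).and
      (hK.eventually_square_coeff_le hα0 hα1 hu hφd hφm (show 0 < ε / 4 by positivity)))
  filter_upwards [eventually_ge_atTop (N + 1)] with k hk z hz
  obtain ⟨n, rfl⟩ : ∃ n, k = n + 1 := ⟨k - 1, by omega⟩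
  have hw := weight_nonneg β hz
  have e1 := (hN n (by omega)).1 z hz
  have e2 := (hN n (by omega)).2 z hz
  generalize 2 * deriv u z * deriv φ z + u z * deriv (deriv φ) z = A at *
  generalize u z * deriv φ z ^ 2 = C at *
  set w := (1 - ‖z‖ ^ 2) ^ β
  have hn0 : (0 : ℝ) ≤ n := n.cast_nonneg
  have hn1 : ‖(n : ℂ) + 1‖ = n + 1 := by
    rw [show (n : ℂ) + 1 = ((n + 1 : ℕ) : ℂ) by push_cast; rfl, Complex.norm_natCast]
    push_cast; rfl
  have htri : ‖A * φ z ^ (n + 1)‖ ≤ ‖φ z ^ n * (A * φ z + (n + 1) * C)‖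
      + ((n : ℝ) + 1) * ‖C * φ z ^ n‖ := by
    rw [← hn1, ← norm_mul]
    refine le_trans (le_of_eq ?_) (norm_sub_le _ _)
    congr 1
    ring
  have hpow : ((n : ℝ) + 2) ^ α ≤ 2 * ((n : ℝ) + 1) ^ α := by
    calc ((n : ℝ) + 2) ^ α ≤ (2 * ((n : ℝ) + 1)) ^ α :=
          Real.rpow_le_rpow (by positivity) (by linarith) hα0.le
      _ = 2 ^ α * ((n : ℝ) + 1) ^ α := Real.mul_rpow (by norm_num) (by positivity)
      _ ≤ 2 ^ (1 : ℝ) * ((n : ℝ) + 1) ^ α := by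
          gcongr
          norm_num
      _ = _ := by rw [Real.rpow_one]
  rw [Real.rpow_add_one (by positivity)] at e2
  have hcast : (((n + 1 : ℕ) : ℝ) + 1) = (n : ℝ) + 2 := by push_cast; ring
  rw [hcast]
  have hwC : 0 ≤ w * ‖C * φ z ^ n‖ := mul_nonneg hw (norm_nonneg _)
  calc _ ≤ ((n : ℝ) + 2) ^ α * (w * (‖φ z ^ n * (A * φ z + (n + 1) * C)‖
      + ((n : ℝ) + 1) * ‖C * φ z ^ n‖)) := by gcongr
    _ = ((n : ℝ) + 2) ^ α * (w * ‖φ z ^ n * (A * φ z + (n + 1) * C)‖)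
      + ((n : ℝ) + 2) ^ α * (((n : ℝ) + 1) * (w * ‖C * φ z ^ n‖)) := by ring
    _ ≤ ε / 2 + 2 * ((n : ℝ) + 1) ^ α * (((n : ℝ) + 1) * (w * ‖C * φ z ^ n‖)) := by gcongr
    _ = ε / 2 + 2 * (((n : ℝ) + 1) ^ α * ((n : ℝ) + 1) * (w * ‖C * φ z ^ n‖)) := by ring
    _ ≤ ε := by linarith

lemma norm_deriv_le_of_blochNorm_le {α r : ℝ} (hα0 : 0 < α) {f : ℂ → ℂ} (hf : MemBloch α f)
    (hr : blochNorm α f ≤ r) :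
    ‖f 0‖ ≤ r ∧ ∀ w ∈ unitDisk, ‖deriv f w‖ ≤ r * (1 - ‖w‖) ^ (-α) := by
  unfold blochNorm at hr
  have hw0 := wnorm_nonneg α (deriv f)
  have hf0 := norm_nonneg (f 0)
  refine ⟨by linarith, fun w hw => ?_⟩
  have h1 := mem_unitDisk_iff.1 hw
  have h0 := norm_nonneg w
  have hd : 0 < 1 - ‖w‖ := by linarith
  have h2 := le_wnorm hf.2 hw
  have h3 : (1 - ‖w‖) ^ α ≤ (1 - ‖w‖ ^ 2) ^ α :=
    Real.rpow_le_rpow hd.le (by nlinarith) hα0.le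
  have h4 := mul_le_mul_of_nonneg_right h3 (norm_nonneg (deriv f w))
  rw [Real.rpow_neg hd.le, ← div_eq_mul_inv, le_div_iff₀ (Real.rpow_pos_of_pos hd α), mul_comm]
  linarith

/-- Radial Hölder estimate for functions with Bloch type growth of the derivative. -/
lemma norm_sub_radial_le {α M s : ℝ} (hα0 : 0 < α) (hα1 : α < 1) (hM : 0 ≤ M) {g : ℂ → ℂ}
    (hg : DifferentiableOn ℂ g unitDisk)
    (hH : ∀ w ∈ unitDisk, ‖deriv g w‖ ≤ M * (1 - ‖w‖) ^ (-α)) (hs0 : 0 ≤ s) (hs1 : s ≤ 1)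
    {w : ℂ} (hw : w ∈ unitDisk) :
    ‖g w - g (s * w)‖ ≤ M / (1 - α) * (1 - s) ^ (1 - α) := by
  have hw1 := mem_unitDisk_iff.1 hw
  have hα' : 0 < 1 - α := by linarith
  have hmem : ∀ t ∈ Set.Icc s 1, ((t : ℂ) * w) ∈ unitDisk := by
    intro t ht
    rw [mem_unitDisk_iff, norm_mul, Complex.norm_real, Real.norm_eq_abs,
      abs_of_nonneg (hs0.trans ht.1)]
    nlinarith [ht.2, norm_nonneg w, hs0.trans ht.1]
  have hderiv : ∀ t ∈ Set.Icc s 1,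
      HasDerivAt (fun t : ℝ => g (t * w) - g (s * w)) (deriv g (t * w) * w) t := by
    intro t ht
    have h1 : HasDerivAt g (deriv g (t * w)) ((t : ℂ) * w) :=
      (hg.differentiableAt (isOpen_unitDisk.mem_nhds (hmem t ht))).hasDerivAt
    have h2 : HasDerivAt (fun x : ℂ => x * w) w (t : ℂ) := by
      simpa using (hasDerivAt_id (t : ℂ)).mul_const w
    exact ((h1.comp (t : ℂ) h2).sub_const _).comp_ofReal
  have key := image_norm_le_of_norm_deriv_right_le_deriv_boundary'
    (f := fun t : ℝ => g (t * w) - g (s * w)) (f' := fun t : ℝ => deriv g (t * w) * w)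
    (a := s) (b := 1) (B := fun t => M / (1 - α) * ((1 - s) ^ (1 - α) - (1 - t) ^ (1 - α)))
    (B' := fun t => M * (1 - t) ^ (-α))
    (fun t ht => (hderiv t ht).continuousAt.continuousWithinAt)
    (fun t ht => (hderiv t (Set.Ico_subset_Icc_self ht)).hasDerivWithinAt)
    (by simp)
    (by
      have : Continuous fun t : ℝ => (1 - t) ^ (1 - α) :=
        (continuous_const.sub continuous_id).rpow_const fun _ => Or.inr hα'.le
      exact (continuous_const.mul (continuous_const.sub this)).continuousOn)
    (fun t ht => by
      have h1 : HasDerivAt (fun x : ℝ => 1 - x) (-1) t := by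
        simpa using (hasDerivAt_id t).const_sub 1
      have h2 := ((h1.rpow_const (p := 1 - α) (Or.inl (by linarith [ht.2]))).const_sub
        ((1 - s) ^ (1 - α))).const_mul (M / (1 - α))
      refine (h2.congr_deriv ?_).hasDerivWithinAt
      rw [show 1 - α - 1 = -α by ring]
      field_simp)
    (fun t ht => by
      have ht0 : 0 ≤ t := hs0.trans ht.1
      have h1 := hH _ (hmem t (Set.Ico_subset_Icc_self ht))
      have h2 : ‖(t : ℂ) * w‖ = t * ‖w‖ := by
        rw [norm_mul, Complex.norm_real, Real.norm_eq_abs, abs_of_nonneg ht0]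
      rw [h2] at h1
      rw [norm_mul]
      calc _ ≤ ‖deriv g (t * w)‖ := mul_le_of_le_one_right (norm_nonneg _) hw1.le
        _ ≤ _ := h1
        _ ≤ _ := by
          refine mul_le_mul_of_nonneg_left ?_ hM
          refine Real.rpow_le_rpow_of_nonpos (by linarith [ht.2]) ?_ (by linarith)
          nlinarith)
    (Set.right_mem_Icc.2 hs1)
  simpa [Real.zero_rpow hα'.ne'] using key

/-- Functions with Bloch type growth, `α < 1`, are uniformly small on the disk as soon as they
are small at suitable finitely many points. -/
lemma exists_finite_norming_set {α M δ : ℝ} (hα0 : 0 < α) (hα1 : α < 1) (hM : 0 ≤ M)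
    (hδ : 0 < δ) :
    ∃ P : Finset ℂ, ↑P ⊆ unitDisk ∧ ∀ g : ℂ → ℂ, DifferentiableOn ℂ g unitDisk →
      (∀ w ∈ unitDisk, ‖deriv g w‖ ≤ M * (1 - ‖w‖) ^ (-α)) →
      (∀ p ∈ P, ‖g p‖ ≤ δ / 3) → ∀ w ∈ unitDisk, ‖g w‖ ≤ δ := by
  have hα' : 0 < 1 - α := by linarith
  obtain ⟨x, hx, hx0, hx1⟩ : ∃ x : ℝ, M / (1 - α) * x ^ (1 - α) ≤ δ / 3 ∧ 0 < x ∧ x < 1 := by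
    have hc : ContinuousAt (fun x : ℝ => M / (1 - α) * x ^ (1 - α)) 0 :=
      continuousAt_const.mul (continuousAt_id.rpow_const (Or.inr hα'.le))
    have h1 := hc.eventually_lt (continuousAt_const (y := δ / 3))
      (by simp [Real.zero_rpow hα'.ne', hδ])
    have h2 : ∀ᶠ x : ℝ in nhdsWithin 0 (Set.Ioi 0), x ∈ Set.Ioo (0 : ℝ) 1 :=
      Ioo_mem_nhdsGT one_pos
    obtain ⟨x, hx, hx2⟩ := ((h1.filter_mono nhdsWithin_le_nhds).and h2).exists
    exact ⟨x, hx.le, hx2.1, hx2.2⟩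
  have hL : 0 ≤ M * x ^ (-α) := mul_nonneg hM (Real.rpow_nonneg hx0.le _)
  obtain ⟨P, hPs, hPf, hP⟩ := (isCompact_closedBall (0 : ℂ) (1 - x)).finite_cover_balls
    (show 0 < δ / (3 * (M * x ^ (-α) + 1)) by positivity)
  have hsub : Metric.closedBall (0 : ℂ) (1 - x) ⊆ unitDisk := by
    intro w hw
    rw [mem_closedBall_zero_iff] at hw
    exact mem_unitDisk_iff.2 (by linarith)
  refine ⟨hPf.toFinset, by simpa using hPs.trans hsub, fun g hg hH hsmall w hw => ?_⟩
  have hw1 := mem_unitDisk_iff.1 hw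
  have hrad := norm_sub_radial_le hα0 hα1 hM hg hH (s := 1 - x) (by linarith) (by linarith) hw
  rw [sub_sub_cancel] at hrad
  have hy : ((1 - x : ℝ) : ℂ) * w ∈ Metric.closedBall (0 : ℂ) (1 - x) := by
    rw [mem_closedBall_zero_iff, norm_mul, Complex.norm_real, Real.norm_eq_abs,
      abs_of_nonneg (by linarith)]
    exact mul_le_of_le_one_right (by linarith) hw1.le
  set y := ((1 - x : ℝ) : ℂ) * w
  obtain ⟨p, hp, hyp⟩ := Set.mem_iUnion₂.1 (hP hy)
  have hlip : ‖g y - g p‖ ≤ M * x ^ (-α) * ‖y - p‖ := by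
    refine Convex.norm_image_sub_le_of_norm_deriv_le (𝕜 := ℂ)
      (s := Metric.closedBall (0 : ℂ) (1 - x))
      (fun v hv => hg.differentiableAt (isOpen_unitDisk.mem_nhds (hsub hv))) (fun v hv => ?_)
      (convex_closedBall _ _) (hPs hp) hy
    refine (hH v (hsub hv)).trans (mul_le_mul_of_nonneg_left ?_ hM)
    rw [mem_closedBall_zero_iff] at hv
    exact Real.rpow_le_rpow_of_nonpos hx0 (by linarith) (by linarith)
  rw [Metric.mem_ball, dist_eq_norm, lt_div_iff₀ (by positivity)] at hyp
  have hgp := hsmall p (by simpa using hp)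
  have h1 : ‖g w‖ ≤ ‖g w - g y‖ + ‖g y - g p‖ + ‖g p‖ := by
    calc ‖g w‖ = ‖(g w - g y) + (g y - g p) + g p‖ := by congr 1; ring
      _ ≤ _ := norm_add₃_le
  nlinarith [norm_nonneg (y - p)]

/-- For `α < 1`, balls of the Bloch type space are totally bounded in the uniform norm. -/
lemma exists_finset_uniform_net {α r δ : ℝ} (hα0 : 0 < α) (hα1 : α < 1) (hr : 0 ≤ r)
    (hδ : 0 < δ) :
    ∃ T : Finset (ℂ → ℂ), (∀ g ∈ T, MemBloch α g ∧ blochNorm α g ≤ r) ∧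
      ∀ f, MemBloch α f → blochNorm α f ≤ r → ∃ g ∈ T, ∀ w ∈ unitDisk, ‖f w - g w‖ ≤ δ := by
  have hα' : 0 < 1 - α := by linarith
  obtain ⟨P, hPd, hP⟩ := exists_finite_norming_set hα0 hα1 (mul_nonneg zero_le_two hr) hδ
  set S : Set (ℂ → ℂ) := {f | MemBloch α f ∧ blochNorm α f ≤ r}
  set Φ : (ℂ → ℂ) → (P → ℂ) := fun f p => f p
  have hbdd : Bornology.IsBounded (Φ '' S) := by
    rw [isBounded_iff_forall_norm_le]
    refine ⟨r + r / (1 - α), ?_⟩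
    rintro _ ⟨f, hf, rfl⟩
    rw [pi_norm_le_iff_of_nonneg (by positivity)]
    intro p
    obtain ⟨h0, hH⟩ := norm_deriv_le_of_blochNorm_le hα0 hf.1 hf.2
    have h1 := norm_sub_radial_le hα0 hα1 hr hf.1.1 hH le_rfl zero_le_one (hPd p.2)
    simp only [Complex.ofReal_zero, zero_mul, sub_zero, Real.one_rpow, mul_one] at h1
    calc ‖f p‖ = ‖f 0 + (f p - f 0)‖ := by congr 1; ring
      _ ≤ ‖f 0‖ + ‖f p - f 0‖ := norm_add_le _ _
      _ ≤ _ := add_le_add h0 h1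
  have htb : TotallyBounded (Φ '' S) :=
    hbdd.isCompact_closure.totallyBounded.subset subset_closure
  obtain ⟨T, hTS, hTf, hT⟩ := Set.exists_subset_image_finite_and.1
    (Metric.finite_approx_of_totallyBounded htb (δ / 3) (by positivity))
  refine ⟨hTf.toFinset, fun g hg => hTS (by simpa using hg), fun f hf hfr => ?_⟩
  obtain ⟨_, ⟨g, hg, rfl⟩, hfg⟩ := Set.mem_iUnion₂.1 (hT (Set.mem_image_of_mem Φ ⟨hf, hfr⟩))
  refine ⟨g, by simpa using hg, ?_⟩
  have hfH := (norm_deriv_le_of_blochNorm_le hα0 hf hfr).2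
  have hgH := (norm_deriv_le_of_blochNorm_le hα0 (hTS hg).1 (hTS hg).2).2
  refine hP (fun w => f w - g w) (hf.1.sub (hTS hg).1.1) (fun w hw => ?_) fun p hp => ?_
  · rw [(deriv_deriv_sub hf.1 (hTS hg).1.1 hw).1]
    refine (norm_sub_le _ _).trans ?_
    linarith [hfH w hw, hgH w hw]
  · rw [Metric.mem_ball, dist_eq_norm] at hfg
    exact (norm_le_pi_norm (Φ f - Φ g) ⟨p, hp⟩).trans hfg.le

/-- Cauchy's estimate on the disk about `w` reaching half way to the boundary. -/
lemma norm_deriv_le_of_half_disk {h : ℂ → ℂ} {C : ℝ} (hh : DifferentiableOn ℂ h unitDisk)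
    {w : ℂ} (hw : w ∈ unitDisk)
    (hC : ∀ ζ ∈ unitDisk, (1 - ‖w‖) / 2 ≤ 1 - ‖ζ‖ → ‖h ζ‖ ≤ C) :
    ‖deriv h w‖ ≤ C / ((1 - ‖w‖) / 2) := by
  have hw1 := mem_unitDisk_iff.1 hw
  have hnorm : ∀ ζ ∈ Metric.closedBall w ((1 - ‖w‖) / 2), (1 - ‖w‖) / 2 ≤ 1 - ‖ζ‖ := by
    intro ζ hζ
    rw [Metric.mem_closedBall, dist_eq_norm] at hζ
    have := norm_sub_norm_le ζ w
    linarith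
  have hsub : Metric.closedBall w ((1 - ‖w‖) / 2) ⊆ unitDisk := fun ζ hζ =>
    mem_unitDisk_iff.2 (by linarith [hnorm ζ hζ])
  refine Complex.norm_deriv_le_of_forall_mem_sphere_norm_le (by linarith)
    (hh.diffContOnCl_ball hsub) fun ζ hζ => ?_
  have hζ' := Metric.sphere_subset_closedBall hζ
  exact hC ζ (hsub hζ') (hnorm ζ hζ')

lemma norm_deriv_deriv_le_of_bloch_growth {α M : ℝ} (hα0 : 0 < α) (hα1 : α < 1) (hM : 0 ≤ M)
    {g : ℂ → ℂ} (hg : DifferentiableOn ℂ g unitDisk)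
    (hH : ∀ w ∈ unitDisk, ‖deriv g w‖ ≤ M * (1 - ‖w‖) ^ (-α)) {w : ℂ} (hw : w ∈ unitDisk) :
    ‖deriv (deriv g) w‖ ≤ 4 * M * (1 - ‖w‖) ^ (-(α + 1)) := by
  have hw1 := mem_unitDisk_iff.1 hw
  have hd : 0 < 1 - ‖w‖ := by linarith
  have h1 := norm_deriv_le_of_half_disk (hg.deriv isOpen_unitDisk) hw
    (C := M * ((1 - ‖w‖) / 2) ^ (-α)) fun ζ hζ hle =>
      (hH ζ hζ).trans (mul_le_mul_of_nonneg_left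
        (Real.rpow_le_rpow_of_nonpos (by linarith) hle (by linarith)) hM)
  refine h1.trans ?_
  have h2 : ((1 - ‖w‖) / 2) ^ (-α) ≤ 2 * (1 - ‖w‖) ^ (-α) := by
    rw [Real.div_rpow hd.le (by norm_num), Real.rpow_neg (by norm_num : (0 : ℝ) ≤ 2) α,
      div_inv_eq_mul, mul_comm]
    refine mul_le_mul_of_nonneg_right ?_ (Real.rpow_nonneg hd.le _)
    simpa using Real.rpow_le_rpow_of_exponent_le (one_le_two : (1 : ℝ) ≤ 2) hα1.le
  have h3 : (1 - ‖w‖) ^ (-(α + 1)) = (1 - ‖w‖) ^ (-α) / (1 - ‖w‖) := by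
    rw [← Real.rpow_sub_one hd.ne']
    ring_nf
  rw [h3]
  calc _ ≤ M * (2 * (1 - ‖w‖) ^ (-α)) / ((1 - ‖w‖) / 2) := by gcongr
    _ = _ := by field_simp; norm_num

lemma norm_deriv_le_of_sup_bound {δ : ℝ} {g : ℂ → ℂ} (hg : DifferentiableOn ℂ g unitDisk)
    (hδ : ∀ w ∈ unitDisk, ‖g w‖ ≤ δ) {w : ℂ} (hw : w ∈ unitDisk) :
    ‖deriv g w‖ ≤ δ / ((1 - ‖w‖) / 2) ∧
      ‖deriv (deriv g) w‖ ≤ 2 * δ / ((1 - ‖w‖) / 2) ^ 2 := by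
  have hd : 0 < 1 - ‖w‖ := by linarith [mem_unitDisk_iff.1 hw]
  have hδ0 : 0 ≤ δ := (norm_nonneg _).trans (hδ w hw)
  have h1 : ∀ ζ ∈ unitDisk, ‖deriv g ζ‖ ≤ δ / ((1 - ‖ζ‖) / 2) := fun ζ hζ =>
    norm_deriv_le_of_half_disk hg hζ fun v hv _ => hδ v hv
  refine ⟨h1 w hw, ?_⟩
  refine (norm_deriv_le_of_half_disk (hg.deriv isOpen_unitDisk) hw
    (C := δ / ((1 - ‖w‖) / 2 / 2)) fun ζ hζ hle => (h1 ζ hζ).trans ?_).trans (le_of_eq ?_)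
  · gcongr
  · field_simp

/-- If the coefficients of `u · C_φ` are dominated near `|φ| = 1`, then `u · C_φ` is small in
`Z_β` on Bloch functions which are uniformly small. -/
lemma exists_zygNorm_wcomp_le {α β K M ε : ℝ} (hα0 : 0 < α) (hα1 : α < 1) (hM : 0 ≤ M)
    (hε : 0 < ε) (hK0 : 0 ≤ K) {u φ : ℂ → ℂ} (hu : DifferentiableOn ℂ u unitDisk)
    (hφd : DifferentiableOn ℂ φ unitDisk) (hφm : Set.MapsTo φ unitDisk unitDisk)
    (hcoeff : ∀ z ∈ unitDisk,
      (1 - ‖z‖ ^ 2) ^ β * ‖deriv (deriv u) z‖ ≤ K ∧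
      (1 - ‖z‖ ^ 2) ^ β * ‖2 * deriv u z * deriv φ z + u z * deriv (deriv φ) z‖ ≤ K ∧
      (1 - ‖z‖ ^ 2) ^ β * ‖u z * deriv φ z ^ 2‖ ≤ K)
    (hA : Tendsto (fun n : ℕ => ((n : ℝ) + 1) ^ α * wnorm β (fun z =>
      (2 * deriv u z * deriv φ z + u z * deriv (deriv φ) z) * φ z ^ n)) atTop (nhds 0))
    (hC : Tendsto (fun n : ℕ => ((n : ℝ) + 1) ^ (α + 1) *
      wnorm β (fun z => u z * deriv φ z ^ 2 * φ z ^ n)) atTop (nhds 0)) :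
    ∃ δ : ℝ, 0 < δ ∧ ∀ g : ℂ → ℂ, DifferentiableOn ℂ g unitDisk →
      (∀ w ∈ unitDisk, ‖deriv g w‖ ≤ M * (1 - ‖w‖) ^ (-α)) →
      (∀ w ∈ unitDisk, ‖g w‖ ≤ δ) → zygNorm β (wcomp u φ g) ≤ ε := by
  have h0 : (0 : ℂ) ∈ unitDisk := mem_unitDisk_iff.2 (by simp)
  set ε₁ := ε / (4 * (5 * M + 1)) with hε₁
  have hε₁0 : 0 < ε₁ := by positivity
  have hε₁M : 5 * M * ε₁ ≤ ε / 4 := by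
    rw [hε₁, mul_div_assoc', div_le_div_iff₀ (by positivity) (by norm_num)]
    nlinarith
  obtain ⟨ρ₁, hρ₁0, hρ₁1, hA'⟩ :=
    exists_weight_le_one_sub_rpow hα0.le hφm (fun z hz => (hcoeff z hz).2.1) hA hε₁0
  obtain ⟨ρ₂, -, hρ₂1, hC'⟩ :=
    exists_weight_le_one_sub_rpow (by linarith) hφm (fun z hz => (hcoeff z hz).2.2) hC hε₁0
  set d := (1 - max ρ₁ ρ₂) / 2 with hd
  have hd0 : 0 < d := by
    have := max_lt hρ₁1 hρ₂1
    linarith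
  set d₀ := (1 - ‖φ 0‖) / 2
  have hd₀ : 0 < d₀ := by
    have := mem_unitDisk_iff.1 (hφm h0)
    simp only [d₀]
    linarith
  set Q₁ := K * (1 + 1 / d + 2 / d ^ 2) with hQ₁
  set Q₂ := ‖u 0‖ + ‖deriv u 0‖ + ‖u 0‖ * ‖deriv φ 0‖ / d₀ with hQ₂
  have hQ₁0 : 0 ≤ Q₁ := by positivity
  have hQ₂0 : 0 ≤ Q₂ := by positivity
  have hKQ : K ≤ Q₁ := by
    refine le_mul_of_one_le_right hK0 ?_
    have : 0 ≤ 1 / d + 2 / d ^ 2 := by positivity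
    linarith
  set δ := ε / (4 * (Q₁ + Q₂ + 1)) with hδ
  have hδ0 : 0 < δ := by positivity
  have hδQ : (Q₁ + Q₂) * δ ≤ ε / 4 := by
    rw [hδ, mul_div_assoc', div_le_div_iff₀ (by positivity) (by norm_num)]
    nlinarith
  have hQ₁δ : Q₁ * δ ≤ ε / 4 := by nlinarith
  have hQ₂δ : Q₂ * δ ≤ ε / 4 := by nlinarith
  refine ⟨δ, hδ0, fun g hg hH hgδ => ?_⟩
  have horigin : ‖wcomp u φ g 0‖ + ‖deriv (wcomp u φ g) 0‖ ≤ Q₂ * δ := by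
    rw [(deriv_deriv_wcomp hu hφd hφm hg h0).1]
    have e1 := hgδ _ (hφm h0)
    have e2 := (norm_deriv_le_of_sup_bound hg hgδ (hφm h0)).1
    have e3 : ‖wcomp u φ g 0‖ = ‖u 0‖ * ‖g (φ 0)‖ := norm_mul _ _
    have e4 := norm_add_le (deriv u 0 * g (φ 0)) (u 0 * (deriv φ 0 * deriv g (φ 0)))
    rw [norm_mul, norm_mul, norm_mul] at e4
    calc _ ≤ ‖u 0‖ * ‖g (φ 0)‖ + (‖deriv u 0‖ * ‖g (φ 0)‖
          + ‖u 0‖ * (‖deriv φ 0‖ * ‖deriv g (φ 0)‖)) := by rw [e3]; gcongr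
      _ ≤ ‖u 0‖ * δ + (‖deriv u 0‖ * δ + ‖u 0‖ * (‖deriv φ 0‖ * (δ / d₀))) := by gcongr
      _ = Q₂ * δ := by rw [hQ₂]; ring
  have hsup : wnorm β (deriv (deriv (wcomp u φ g))) ≤ ε / 2 := by
    refine wnorm_le (by positivity) fun z hz => ?_
    have hw := weight_nonneg β hz
    obtain ⟨k0, k1, k2⟩ := hcoeff z hz
    have hA₁ := hA' z hz
    have hC₁ := hC' z hz
    have g0 := hgδ _ (hφm hz)
    have hx : 0 < 1 - ‖φ z‖ := by linarith [mem_unitDisk_iff.1 (hφm hz)]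
    rw [(deriv_deriv_wcomp hu hφd hφm hg hz).2]
    generalize 2 * deriv u z * deriv φ z + u z * deriv (deriv φ) z = A at *
    generalize u z * deriv φ z ^ 2 = C at *
    set w := (1 - ‖z‖ ^ 2) ^ β
    have htri : w * ‖deriv (deriv u) z * g (φ z) + A * deriv g (φ z) + C * deriv (deriv g) (φ z)‖
        ≤ w * ‖deriv (deriv u) z‖ * ‖g (φ z)‖ + w * ‖A‖ * ‖deriv g (φ z)‖
          + w * ‖C‖ * ‖deriv (deriv g) (φ z)‖ := by
      calc _ ≤ w * (‖deriv (deriv u) z‖ * ‖g (φ z)‖ + ‖A‖ * ‖deriv g (φ z)‖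
            + ‖C‖ * ‖deriv (deriv g) (φ z)‖) := by
            rw [← norm_mul, ← norm_mul, ← norm_mul]
            exact mul_le_mul_of_nonneg_left norm_add₃_le hw
        _ = _ := by ring
    refine htri.trans ?_
    rcases le_or_gt (‖φ z‖) (max ρ₁ ρ₂) with hle | hgt
    · obtain ⟨g1, g2⟩ := norm_deriv_le_of_sup_bound hg hgδ (hφm hz)
      have hdz : d ≤ (1 - ‖φ z‖) / 2 := by rw [hd]; linarith
      have g1' : ‖deriv g (φ z)‖ ≤ δ / d := g1.trans (by gcongr)
      have g2' : ‖deriv (deriv g) (φ z)‖ ≤ 2 * δ / d ^ 2 := g2.trans (by gcongr)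
      calc _ ≤ K * δ + K * (δ / d) + K * (2 * δ / d ^ 2) := by gcongr
        _ = Q₁ * δ := by rw [hQ₁]; ring
        _ ≤ ε / 2 := by linarith
    · have hA₂ := hA₁ ((le_max_left _ _).trans_lt hgt)
      have hC₂ := hC₁ ((le_max_right _ _).trans_lt hgt)
      have g1 := hH _ (hφm hz)
      have g2 := norm_deriv_deriv_le_of_bloch_growth hα0 hα1 hM hg hH (hφm hz)
      have hc1 : (1 - ‖φ z‖) ^ α * (1 - ‖φ z‖) ^ (-α) = 1 := by
        rw [← Real.rpow_add hx]; simp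
      have hc2 : (1 - ‖φ z‖) ^ (α + 1) * (1 - ‖φ z‖) ^ (-(α + 1)) = 1 := by
        rw [← Real.rpow_add hx, add_neg_cancel, Real.rpow_zero]
      calc _ ≤ K * δ + (ε₁ * (1 - ‖φ z‖) ^ α) * (M * (1 - ‖φ z‖) ^ (-α))
            + (ε₁ * (1 - ‖φ z‖) ^ (α + 1)) * (4 * M * (1 - ‖φ z‖) ^ (-(α + 1))) := by gcongr
        _ = K * δ + M * ε₁ * ((1 - ‖φ z‖) ^ α * (1 - ‖φ z‖) ^ (-α))
            + 4 * M * ε₁ * ((1 - ‖φ z‖) ^ (α + 1) * (1 - ‖φ z‖) ^ (-(α + 1))) := by ring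
        _ = K * δ + 5 * M * ε₁ := by rw [hc1, hc2]; ring
        _ ≤ Q₁ * δ + 5 * M * ε₁ := by gcongr
        _ ≤ ε / 2 := by linarith
  unfold zygNorm
  linarith

/-- **Corollary 4.6 (i)**. For `0 < α < 1`, `uC_φ : B^α → Z_β` is compact iff it is
bounded, `(n+1)^α ‖(2u'φ'+uφ'')φ^n‖_ν_β → 0` and `(n+1)^(α+1) ‖u(φ')²φ^n‖_ν_β → 0`. -/
theorem weighted_comp_compact_Bloch_to_Zygmund_iff_of_lt_one
    (α β : ℝ) (hα0 : 0 < α) (hα1 : α < 1) (hβ : 0 < β)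
    (u φ : ℂ → ℂ) (hu : DifferentiableOn ℂ u unitDisk)
    (hφd : DifferentiableOn ℂ φ unitDisk) (hφm : Set.MapsTo φ unitDisk unitDisk) :
    CompactBlochToZygmund α β u φ ↔
      BoundedBlochToZygmund α β u φ ∧
      Filter.Tendsto (fun n : ℕ => ((n : ℝ) + 1) ^ α * wnorm β (fun z => (2 * deriv u z * deriv φ z + u z * deriv (deriv φ) z) * φ z ^ n))
        Filter.atTop (nhds 0) ∧
      Filter.Tendsto (fun n : ℕ => ((n : ℝ) + 1) ^ (α + 1) * wnorm β (fun z => u z * deriv φ z ^ 2 * φ z ^ n))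
        Filter.atTop (nhds 0) := by
  constructor
  · intro hK
    exact ⟨hK.1,
      tendsto_mul_wnorm_zero (fun n => by positivity) fun ε hε =>
        hK.eventually_linear_coeff_le hα0 hα1 hu hφd hφm hε,
      tendsto_mul_wnorm_zero (fun n => by positivity) fun ε hε =>
        hK.eventually_square_coeff_le hα0 hα1 hu hφd hφm hε⟩
  · rintro ⟨hB, hA, hC⟩
    refine ⟨hB, fun r ε hε => ?_⟩
    obtain ⟨K, hK0, hcoeff⟩ := hB.exists_coeff_bound hα0 hu hφd hφm
    have hR : 0 ≤ max r 0 := le_max_right _ _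
    obtain ⟨δ, hδ, hsmall⟩ := exists_zygNorm_wcomp_le hα0 hα1
      (mul_nonneg zero_le_two hR) hε hK0 hu hφd hφm hcoeff hA hC
    obtain ⟨T, hT, hnet⟩ := exists_finset_uniform_net hα0 hα1 hR hδ
    classical
    refine ⟨T.image (wcomp u φ), fun g hg => ?_, fun f hf hfr => ?_⟩
    · obtain ⟨h, hh, rfl⟩ := Finset.mem_image.1 hg
      exact hB.1 h (hT h hh).1
    have hfR := hfr.trans (le_max_left r 0)
    obtain ⟨g, hg, hfg⟩ := hnet f hf hfR
    refine ⟨wcomp u φ g, Finset.mem_image_of_mem _ hg, ?_⟩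
    have heq : (fun z => wcomp u φ f z - wcomp u φ g z) = wcomp u φ (fun w => f w - g w) := by
      funext z
      simp only [wcomp, mul_sub]
    rw [heq]
    refine hsmall _ (hf.1.sub (hT g hg).1.1) (fun w hw => ?_) hfg
    rw [(deriv_deriv_sub hf.1 (hT g hg).1.1 hw).1]
    refine (norm_sub_le _ _).trans ?_
    linarith [(norm_deriv_le_of_blochNorm_le hα0 hf hfR).2 w hw,
      (norm_deriv_le_of_blochNorm_le hα0 (hT g hg).1 (hT g hg).2).2 w hw]

end
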